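/- Let d ≥ 1, p₀ = 1 + 4/d. Suppose Q, ρ : ℝ^d → ℝ are Schwartz functions with ΔQ − Q + Q^{p₀} = 0 and L₊ρ = |x|²Q, where L₊ = −Δ + 1 − p₀Q^{p₀−1}. Then ∫_{ℝ^d} ρ Q dx = (1/2) ∫_{ℝ^d} |x|² Q² dx. -/

import Mathlib

open MeasureTheory

/-- The Euclidean Laplacian `Δu(x) = ∑ᵢ ∂ᵢ²u(x)`. -/
noncomputable def lapl {d : ℕ} (u : EuclideanSpace ℝ (Fin d) → ℝ)
    (x : EuclideanSpace ℝ (Fin d)) : ℝ :=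
  ∑ i : Fin d,
    fderiv ℝ (fun y => fderiv ℝ u y (EuclideanSpace.single i 1)) x (EuclideanSpace.single i 1)

open scoped SchwartzMap LineDeriv Laplacian

namespace Aux

abbrev E (d : ℕ) := EuclideanSpace ℝ (Fin d)

noncomputable abbrev ee {d : ℕ} (i : Fin d) : E d := EuclideanSpace.single i (1 : ℝ)

lemma tg {d : ℕ} (j : Fin d) : (fun x : E d => x j).HasTemperateGrowth :=
  (EuclideanSpace.proj j : E d →L[ℝ] ℝ).hasTemperateGrowth

noncomputable def X {d : ℕ} (j : Fin d) (g : 𝓢(E d, ℝ)) : 𝓢(E d, ℝ) :=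
  SchwartzMap.smulLeftCLM ℝ (fun x : E d => x j) g

noncomputable def N {d : ℕ} (g : 𝓢(E d, ℝ)) : 𝓢(E d, ℝ) :=
  SchwartzMap.smulLeftCLM ℝ (fun x : E d => ‖x‖ ^ 2) g

lemma X_apply {d : ℕ} (j : Fin d) (g : 𝓢(E d, ℝ)) (x : E d) : X j g x = x j * g x := by
  rw [X, SchwartzMap.smulLeftCLM_apply_apply (tg j), smul_eq_mul]

lemma N_apply {d : ℕ} (g : 𝓢(E d, ℝ)) (x : E d) : N g x = ‖x‖ ^ 2 * g x := by
  rw [N, SchwartzMap.smulLeftCLM_apply_apply, smul_eq_mul]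
  fun_prop

lemma dX {d : ℕ} (i j : Fin d) (g : 𝓢(E d, ℝ)) :
    ∂_{ee i} (X j g) = (if i = j then g else 0) + X j (∂_{ee i} g) := by
  ext x
  rw [_root_.add_apply, X_apply, SchwartzMap.lineDerivOp_apply_eq_fderiv,
    SchwartzMap.lineDerivOp_apply_eq_fderiv]
  have h1 : HasFDerivAt (fun x : E d => x j)
      (EuclideanSpace.proj j : E d →L[ℝ] ℝ) x :=
    (EuclideanSpace.proj j : E d →L[ℝ] ℝ).hasFDerivAt
  have h2 : HasFDerivAt g (fderiv ℝ g x) x := g.differentiableAt.hasFDerivAt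
  have h3 : (X j g : E d → ℝ) = (fun x : E d => x j) * ⇑g := by
    ext y; simp [X_apply]
  rw [h3, (h1.mul h2).fderiv]
  by_cases hij : i = j
  · subst hij; simp; ring
  · simp [hij, Ne.symm hij]

lemma dN {d : ℕ} (i : Fin d) (g : 𝓢(E d, ℝ)) (x : E d) :
    ∂_{ee i} (N g) x = 2 * x i * g x + ‖x‖ ^ 2 * ∂_{ee i} g x := by
  rw [SchwartzMap.lineDerivOp_apply_eq_fderiv,
    SchwartzMap.lineDerivOp_apply_eq_fderiv]
  have h1 : HasFDerivAt (fun x : E d => ‖x‖ ^ 2) (2 • innerSL ℝ x) x :=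
    (hasStrictFDerivAt_norm_sq x).hasFDerivAt
  have h2 : HasFDerivAt g (fderiv ℝ g x) x := g.differentiableAt.hasFDerivAt
  have h3 : (N g : E d → ℝ) = (fun x : E d => ‖x‖ ^ 2) * ⇑g := by
    ext y; simp [N_apply]
  rw [h3, (h1.mul h2).fderiv]
  simp [EuclideanSpace.inner_single_right]; ring

lemma lap_eq {d : ℕ} (g : 𝓢(E d, ℝ)) : Δ g = ∑ i : Fin d, ∂_{ee i} (∂_{ee i} g) := by
  rw [SchwartzMap.laplacian_eq_sum (EuclideanSpace.basisFun (Fin d) ℝ)]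
  simp

lemma lapl_eq {d : ℕ} (g : 𝓢(E d, ℝ)) (x : E d) : lapl (⇑g) x = Δ g x := by
  rw [lap_eq, _root_.sum_apply]
  rfl

lemma swap {d : ℕ} (v w : E d) (g : 𝓢(E d, ℝ)) : ∂_{v} (∂_{w} g) = ∂_{w} (∂_{v} g) := by
  ext x
  have key (v w : E d) : ∂_{v} (∂_{w} g) x = fderiv ℝ (fderiv ℝ g) x v w := by
    have h : DifferentiableAt ℝ (fderiv ℝ g) x :=
      ((g.smooth 2).fderiv_right (m := 1) (by norm_num)).differentiable (by norm_num) x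
    rw [SchwartzMap.lineDerivOp_apply_eq_fderiv]
    change fderiv ℝ (fun y => fderiv ℝ g y w) x v = _
    rw [fderiv_clm_apply h (by fun_prop)]
    simp
  rw [key, key]
  exact ((g.smooth 2).contDiffAt.isSymmSndFDerivAt (by simp)) v w

lemma lap_X {d : ℕ} (j : Fin d) (g : 𝓢(E d, ℝ)) (x : E d) :
    Δ (X j g) x = x j * Δ g x + 2 * ∂_{ee j} g x := by
  have h (i : Fin d) : ∂_{ee i} (∂_{ee i} (X j g)) x =
      x j * ∂_{ee i} (∂_{ee i} g) x + if i = j then 2 * ∂_{ee j} g x else 0 := by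
    rw [dX, LineDeriv.lineDerivOp_add, dX]
    by_cases hij : i = j
    · subst hij; simp [X_apply]; ring
    · simp [hij, X_apply, SchwartzMap.lineDerivOp_apply_eq_fderiv]
  rw [lap_eq, lap_eq, _root_.sum_apply, _root_.sum_apply,
    Finset.sum_congr rfl (fun i _ => h i), Finset.sum_add_distrib, Finset.mul_sum]
  simp

lemma lap_d {d : ℕ} (j : Fin d) (g : 𝓢(E d, ℝ)) :
    Δ (∂_{ee j} g) = ∂_{ee j} (Δ g) := by
  rw [lap_eq, lap_eq, LineDeriv.lineDerivOp_sum]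
  refine Finset.sum_congr rfl fun i _ => ?_
  rw [swap (ee i) (ee j) g, swap (ee i) (ee j)]

lemma deriv_f (α : ℝ) (hα : 0 < α) (s : ℝ) :
    HasDerivAt (fun s : ℝ => |s| ^ α * s) ((1 + α) * |s| ^ α) s := by
  rcases eq_or_ne s 0 with rfl | hs
  · rw [hasDerivAt_iff_tendsto_slope]
    have hc : Continuous (fun s : ℝ => |s| ^ α) :=
      continuous_abs.rpow_const (fun _ => Or.inr hα.le)
    have := (hc.tendsto 0).mono_left (nhdsWithin_le_nhds (s := {0}ᶜ))
    simp only [abs_zero, Real.zero_rpow hα.ne', mul_zero] at this ⊢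
    refine this.congr' ?_
    filter_upwards [self_mem_nhdsWithin] with y hy
    have hy : y ≠ 0 := hy
    simp [slope_def_field, hy]
  · have h1 := (hasDerivAt_abs hs).rpow_const (p := α) (Or.inl (abs_ne_zero.2 hs))
    have h2 := h1.mul (hasDerivAt_id s)
    refine h2.congr_deriv ?_
    have h3 : |s| ^ (α - 1) * |s| = |s| ^ α := by
      rw [Real.rpow_sub_one (abs_ne_zero.2 hs)]; field_simp [abs_ne_zero.2 hs]
    have h4 : (SignType.sign s : ℝ) * s = |s| := by
      exact sign_mul_self s
    simp only [id, mul_one]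
    linear_combination α * |s| ^ (α - 1) * h4 + α * h3

/-- the generator of scaling applied to `Q`. -/
noncomputable def Lam {d : ℕ} (Q : 𝓢(E d, ℝ)) : 𝓢(E d, ℝ) :=
  ((d : ℝ) / 2) • Q + ∑ j, X j (∂_{ee j} Q)

lemma Lam_apply {d : ℕ} (Q : 𝓢(E d, ℝ)) (x : E d) :
    Lam Q x = (d : ℝ) / 2 * Q x + ∑ j, x j * ∂_{ee j} Q x := by
  simp [Lam, _root_.sum_apply, X_apply]

lemma mul_int {d : ℕ} (f g : 𝓢(E d, ℝ)) : Integrable (fun x => f x * g x) := by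
  exact (SchwartzMap.pairing (ContinuousLinearMap.mul ℝ ℝ) f g).integrable

lemma mul_int_add {d : ℕ} (f g h k : 𝓢(E d, ℝ)) :
    Integrable (fun x => f x * g x + 2 * (h x * k x)) :=
  (mul_int f g).add ((mul_int h k).const_mul 2)

lemma mul_int_sub {d : ℕ} (f g h k : 𝓢(E d, ℝ)) :
    Integrable (fun x => f x * g x - h x * k x) :=
  (mul_int f g).sub (mul_int h k)

lemma lap_Lam {d : ℕ} (hd : 1 ≤ d) (Q : 𝓢(E d, ℝ))
    (hQ : ∀ x, Δ Q x - Q x + |Q x| ^ (4 / (d : ℝ)) * Q x = 0) (x : E d) :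
    -(Δ (Lam Q) x) + Lam Q x - (1 + 4 / (d : ℝ)) * |Q x| ^ (4 / (d : ℝ)) * Lam Q x
      = -2 * Q x := by
  have hd0 : (d : ℝ) ≠ 0 := by positivity
  have hα : 0 < 4 / (d : ℝ) := by positivity
  have hD (j : Fin d) : Δ (∂_{ee j} Q) x =
      ∂_{ee j} Q x - (1 + 4 / (d : ℝ)) * |Q x| ^ (4 / (d : ℝ)) * ∂_{ee j} Q x := by
    rw [lap_d, SchwartzMap.lineDerivOp_apply_eq_fderiv, SchwartzMap.lineDerivOp_apply_eq_fderiv]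
    have h0 : (⇑(Δ Q : 𝓢(E d, ℝ)) : E d → ℝ) = fun y => Q y - |Q y| ^ (4 / (d : ℝ)) * Q y := by
      ext y; linarith [hQ y]
    have h2 : HasFDerivAt Q (fderiv ℝ Q x) x := Q.differentiableAt.hasFDerivAt
    have h3 := h2.sub ((deriv_f _ hα (Q x)).comp_hasFDerivAt x h2)
    have h4 : fderiv ℝ (fun y => Q y - |Q y| ^ (4 / (d : ℝ)) * Q y) x = _ := h3.fderiv
    rw [h0, h4]
    simp
  have hL : Δ (Lam Q) x = (d : ℝ) / 2 * Δ Q x + ∑ j, x j * Δ (∂_{ee j} Q) x + 2 * Δ Q x := by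
    have : Δ (Lam Q) = ((d : ℝ) / 2) • Δ Q + ∑ j, Δ (X j (∂_{ee j} Q)) := by
      simp only [Lam, ← SchwartzMap.laplacianCLM_eq ℝ, map_add, map_smul, map_sum]
    rw [this, _root_.add_apply, _root_.sum_apply]
    simp_rw [lap_X]
    rw [Finset.sum_add_distrib, ← Finset.mul_sum]
    have : ∑ j : Fin d, (∂_{ee j} (∂_{ee j} Q) : 𝓢(E d, ℝ)) x = Δ Q x := by rw [lap_eq, _root_.sum_apply]
    rw [this]; simp; ring
  rw [hL, Lam_apply]
  simp_rw [hD]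
  have : ∑ j, x j * (∂_{ee j} Q x - (1 + 4 / (d : ℝ)) * |Q x| ^ (4 / (d : ℝ)) * ∂_{ee j} Q x)
      = (1 - (1 + 4 / (d : ℝ)) * |Q x| ^ (4 / (d : ℝ))) * ∑ j, x j * ∂_{ee j} Q x := by
    rw [Finset.mul_sum]; exact Finset.sum_congr rfl fun _ _ => by ring
  rw [this]
  have hq : Δ Q x = Q x - |Q x| ^ (4 / (d : ℝ)) * Q x := by linarith [hQ x]
  rw [hq]
  field_simp
  ring

lemma int_Lam {d : ℕ} (Q : 𝓢(E d, ℝ)) :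
    ∫ x, N Q x * Lam Q x = - ∫ x, N Q x * Q x := by
  have hj (j : Fin d) : ∫ x, N Q x * X j (∂_{ee j} Q) x =
      - ((∫ x, N Q x * Q x) + 2 * (∫ x, X j Q x * X j Q x)
        + ∫ x, N Q x * X j (∂_{ee j} Q) x) := by
    have h := SchwartzMap.integral_mul_lineDerivOp_right_eq_neg_left (μ := volume)
      (X j (N Q)) Q (ee j)
    have h1 : ∀ x, X j (N Q) x * ∂_{ee j} Q x = N Q x * X j (∂_{ee j} Q) x := by
      intro x; simp only [X_apply]; ring
    have h2 : ∀ x, ∂_{ee j} (X j (N Q)) x * Q x =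
        N Q x * Q x + 2 * (X j Q x * X j Q x) + N Q x * X j (∂_{ee j} Q) x := by
      intro x; rw [dX]; simp only [if_true, _root_.add_apply, X_apply, dN, N_apply]; ring
    simp_rw [h1, h2] at h
    rw [integral_add (mul_int_add _ _ _ _) (mul_int _ _),
      integral_add (mul_int _ _) ((mul_int _ _).const_mul 2), integral_const_mul] at h
    exact h
  have hs : ∑ j : Fin d, ∫ x, X j Q x * X j Q x = ∫ x, N Q x * Q x := by
    rw [← integral_finsetSum _ (fun j _ => mul_int _ _)]
    congr 1; ext x
    simp only [X_apply, N_apply, EuclideanSpace.real_norm_sq_eq]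
    rw [Finset.sum_mul, Finset.sum_mul]
    exact Finset.sum_congr rfl fun _ _ => by ring
  have hl : ∫ x, N Q x * Lam Q x = (d : ℝ) / 2 * (∫ x, N Q x * Q x)
      + ∑ j : Fin d, ∫ x, N Q x * X j (∂_{ee j} Q) x := by
    rw [← integral_finsetSum _ (fun j _ => mul_int _ _), ← integral_const_mul,
      ← integral_add ((mul_int _ _).const_mul _) (integrable_finsetSum _ fun j _ => mul_int _ _)]
    congr 1; ext x
    rw [Lam_apply, ← Finset.mul_sum]
    simp only [X_apply]; ring
  have ht := Finset.sum_congr (rfl : (Finset.univ : Finset (Fin d)) = _) (fun j _ => hj j)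
  rw [Finset.sum_neg_distrib, Finset.sum_add_distrib, Finset.sum_add_distrib, ← Finset.mul_sum,
    hs] at ht
  simp only [Finset.sum_const, Finset.card_univ, Fintype.card_fin, nsmul_eq_mul] at ht
  rw [hl]
  linarith

end Aux

/-- If `Q, ρ` are Schwartz, `ΔQ − Q + Q^{p₀} = 0` with `p₀ = 1 + 4/d`
(the nonlinearity being `|Q|^{p₀−1}Q`), and `L₊ρ = |x|²Q` where
`L₊ = −Δ + 1 − p₀ Q^{p₀−1}`, then `∫ ρQ = (1/2)∫ |x|²Q²`. -/
theorem statement2 (d : ℕ) (hd : 1 ≤ d)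
    (Q ρ : SchwartzMap (EuclideanSpace ℝ (Fin d)) ℝ)
    (hQ : ∀ x, lapl (⇑Q) x - Q x + |Q x| ^ (4 / (d : ℝ)) * Q x = 0)
    (hρ : ∀ x, -(lapl (⇑ρ) x) + ρ x - (1 + 4 / (d : ℝ)) * |Q x| ^ (4 / (d : ℝ)) * ρ x
      = ‖x‖ ^ 2 * Q x) :
    ∫ x : EuclideanSpace ℝ (Fin d), ρ x * Q x
      = (1 / 2) * ∫ x : EuclideanSpace ℝ (Fin d), ‖x‖ ^ 2 * (Q x) ^ 2 := by

  classical
  simp only [Aux.lapl_eq] at hQ hρ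
  have h1 := Aux.lap_Lam hd Q hQ
  have h2 : ∀ x, ρ x * Q x = (1 / 2) * (ρ x * Δ (Aux.Lam Q) x - Δ ρ x * Aux.Lam Q x
      - Aux.N Q x * Aux.Lam Q x) := by
    intro x
    rw [Aux.N_apply]
    linear_combination (1 / 2) * ρ x * h1 x - (1 / 2) * Aux.Lam Q x * hρ x
  simp_rw [h2]
  rw [integral_const_mul, integral_sub (Aux.mul_int_sub _ _ _ _)
    (Aux.mul_int _ _), integral_sub (Aux.mul_int _ _) (Aux.mul_int _ _), Aux.int_Lam,
    SchwartzMap.integral_mul_laplacian_right_eq_left]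
  simp_rw [Aux.N_apply]
  rw [sub_self, zero_sub, neg_neg]
  congr 2; ext x; ring
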